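/- Let α ∈ IF_n. Then there exist ω₁, ω₂ ∈ ⟨J⟩ with ω₁⁻¹, ω₂⁻¹ ∈ ⟨J⟩ such that dom α ⊆ im ω₁, im α ⊆ dom ω₂, and a(ω₁αω₂) = a for all a ∈ dom(ω₁αω₂), i.e. the product ω₁αω₂ is a restriction of the identity map of X_n. -/

import Mathlib

/-!
Common framework: partial injections on `X_n = {1, …, n}`, the fence order,
fence-preserving partial injections, the semigroups `PFI_n`, `IF_n`,
the set `J` of elements of rank at least `n - 2`, and (for even `n`)
the generating system `G`.
-/

namespace FencePaper

/-- The fence (zigzag) order on `{1, …, n}`: `a <_f b` iff `|a - b| = 1` and `b` is even. -/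
def fenceLt (a b : ℕ) : Prop := (a + 1 = b ∨ b + 1 = a) ∧ Even b

/-- A partial injection of `X_n = {1, …, n}`, given by its graph. -/
structure PartialInj (n : ℕ) where
  graph : Set (ℕ × ℕ)
  mem_le : ∀ p ∈ graph, 1 ≤ p.1 ∧ p.1 ≤ n ∧ 1 ≤ p.2 ∧ p.2 ≤ n
  functional : ∀ p ∈ graph, ∀ q ∈ graph, p.1 = q.1 → p.2 = q.2
  injOn : ∀ p ∈ graph, ∀ q ∈ graph, p.2 = q.2 → p.1 = q.1

namespace PartialInj

variable {n : ℕ}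

theorem ext' {α β : PartialInj n} (h : α.graph = β.graph) : α = β := by
  cases α
  cases β
  simp only at h
  subst h
  rfl

/-- The domain of a partial injection. -/
def dom (α : PartialInj n) : Set ℕ := {x | ∃ y, (x, y) ∈ α.graph}

/-- The image (range) of a partial injection. -/
def im (α : PartialInj n) : Set ℕ := {y | ∃ x, (x, y) ∈ α.graph}

/-- The rank of a partial injection: the cardinality of its image. -/
noncomputable def rank (α : PartialInj n) : ℕ := α.im.ncard

/-- The inverse partial injection. -/
def inv (α : PartialInj n) : PartialInj n where
  graph := {p | (p.2, p.1) ∈ α.graph}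
  mem_le := by
    rintro p hp
    obtain ⟨h1, h2, h3, h4⟩ := α.mem_le _ hp
    exact ⟨h3, h4, h1, h2⟩
  functional := by
    rintro p hp q hq h
    exact α.injOn _ hp _ hq h
  injOn := by
    rintro p hp q hq h
    exact α.functional _ hp _ hq h

/-- Composition: first `α`, then `β` (maps act on the right). -/
def comp (α β : PartialInj n) : PartialInj n where
  graph := {p | ∃ y, (p.1, y) ∈ α.graph ∧ (y, p.2) ∈ β.graph}
  mem_le := by
    rintro p ⟨y, h1, h2⟩
    obtain ⟨a, b, -, -⟩ := α.mem_le _ h1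
    obtain ⟨-, -, c, d⟩ := β.mem_le _ h2
    exact ⟨a, b, c, d⟩
  functional := by
    rintro p ⟨y, h1, h2⟩ q ⟨z, h3, h4⟩ h
    have hyz : y = z := α.functional _ h1 _ h3 h
    subst hyz
    exact β.functional (y, p.2) h2 (y, q.2) h4 rfl
  injOn := by
    rintro p ⟨y, h1, h2⟩ q ⟨z, h3, h4⟩ h
    have hyz : y = z := β.injOn _ h2 _ h4 h
    subst hyz
    exact α.injOn (p.1, y) h1 (q.1, y) h3 rfl

/-- The partial identity map on `D ∩ {1, …, n}`. -/
def pid (n : ℕ) (D : Set ℕ) : PartialInj n where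
  graph := {p | p.1 ∈ Set.Icc 1 n ∧ p.1 ∈ D ∧ p.2 = p.1}
  mem_le := by
    rintro p ⟨⟨h1, h2⟩, -, h3⟩
    refine ⟨h1, h2, ?_, ?_⟩ <;> omega
  functional := by
    rintro p ⟨-, -, h1⟩ q ⟨-, -, h2⟩ h
    rw [h1, h2, h]
  injOn := by
    rintro p ⟨-, -, h1⟩ q ⟨-, -, h2⟩ h
    rw [← h1, ← h2, h]

instance : Monoid (PartialInj n) where
  mul := comp
  one := pid n (Set.Icc 1 n)
  mul_assoc a b c := by
    apply ext'
    ext q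
    constructor
    · rintro ⟨y, ⟨z, h1, h2⟩, h3⟩
      exact ⟨z, h1, y, h2, h3⟩
    · rintro ⟨z, h1, y, h2, h3⟩
      exact ⟨y, ⟨z, h1, h2⟩, h3⟩
  one_mul a := by
    apply ext'
    ext q
    constructor
    · rintro ⟨y, ⟨-, -, h⟩, h2⟩
      have hy : y = q.1 := h
      rw [hy] at h2
      exact h2
    · intro hq
      obtain ⟨h1, h2, -, -⟩ := a.mem_le _ hq
      exact ⟨q.1, ⟨⟨h1, h2⟩, ⟨h1, h2⟩, rfl⟩, hq⟩
  mul_one a := by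
    apply ext'
    ext q
    constructor
    · rintro ⟨y, h1, ⟨-, -, h⟩⟩
      have hy : q.2 = y := h
      rw [← hy] at h1
      exact h1
    · intro hq
      obtain ⟨-, -, h3, h4⟩ := a.mem_le _ hq
      exact ⟨q.2, hq, ⟨h3, h4⟩, ⟨h3, h4⟩, rfl⟩

theorem mul_graph (α β : PartialInj n) :
    (α * β).graph = {p | ∃ y, (p.1, y) ∈ α.graph ∧ (y, p.2) ∈ β.graph} := rfl

/-- `α` is fence-preserving. -/
def FP (α : PartialInj n) : Prop :=
  ∀ p ∈ α.graph, ∀ q ∈ α.graph, fenceLt p.1 q.1 → fenceLt p.2 q.2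

/-- The image of a subset under a partial injection. -/
def imageOf (α : PartialInj n) (S : Set ℕ) : Set ℕ := {y | ∃ x ∈ S, (x, y) ∈ α.graph}

end PartialInj

open PartialInj

/-- `PFI_n`: the semigroup of all fence-preserving partial injections. -/
def PFIset (n : ℕ) : Set (PartialInj n) := {α | α.FP}

/-- `IF_n = {α ∈ PFI_n : α⁻¹ ∈ PFI_n}`. -/
def IFset (n : ℕ) : Set (PartialInj n) := {α | α.FP ∧ α.inv.FP}

/-- `J = {α ∈ IF_n : rank α ≥ n - 2}`. -/
def Jset (n : ℕ) : Set (PartialInj n) := {α | α ∈ IFset n ∧ n - 2 ≤ α.rank}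

/-- `A` is a maximal block of consecutive integers of `D ⊆ {1, …, n}`. -/
def IsBlock (n : ℕ) (D A : Set ℕ) : Prop :=
  ∃ i r : ℕ, 1 ≤ i ∧ A = Set.Icc i (i + r) ∧ A ⊆ D ∧
    (i = 1 ∨ i - 1 ∉ D) ∧ (i + r = n ∨ i + r + 1 ∉ D)

/-- `α(k)`: the maximal blocks of `dom α` of cardinality `k`. -/
def blockSet {n : ℕ} (α : PartialInj n) (k : ℕ) : Set (Set ℕ) :=
  {A | IsBlock n α.dom A ∧ A.ncard = k}

/-- `α°(2k+1)`: the maximal blocks `{i, …, i+2k}` of `dom α` with `i` odd. -/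
def oddBlockSet {n : ℕ} (α : PartialInj n) (k : ℕ) : Set (Set ℕ) :=
  {A | A ∈ blockSet α (2 * k + 1) ∧ Odd (sInf A)}

/-- The graph of `σ₁`: domain `X_n ∖ {2}`, `1 ↦ n`, `x ↦ x - 2` for `3 ≤ x ≤ n`. -/
def sigma1Graph (n : ℕ) : Set (ℕ × ℕ) :=
  {q | 1 ≤ q.1 ∧ q.1 ≤ n ∧ q.1 ≠ 2 ∧ q.2 = if q.1 = 1 then n else q.1 - 2}

/-- The graph of `σ₂ = σ₁⁻¹`: domain `X_n ∖ {n-1}`, `x ↦ x + 2` for `x ≤ n - 2`, `n ↦ 1`. -/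
def sigma2Graph (n : ℕ) : Set (ℕ × ℕ) :=
  {q | 1 ≤ q.1 ∧ q.1 ≤ n ∧ q.1 ≠ n - 1 ∧ q.2 = if q.1 = n then 1 else q.1 + 2}

/-- The graph of `γ_i`: domain `X_n ∖ {i}`, `x ↦ i - x` for `x < i`, `x ↦ x` for `x > i`. -/
def gammaGraph (n i : ℕ) : Set (ℕ × ℕ) :=
  {q | 1 ≤ q.1 ∧ q.1 ≤ n ∧ q.1 ≠ i ∧ q.2 = if q.1 < i then i - q.1 else q.1}

/-- The graph of `δ_i`: domain `X_n ∖ {i}`, `x ↦ x` for `x < i`, `x ↦ n + i + 1 - x` for `x > i`. -/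
def deltaGraph (n i : ℕ) : Set (ℕ × ℕ) :=
  {q | 1 ≤ q.1 ∧ q.1 ≤ n ∧ q.1 ≠ i ∧ q.2 = if q.1 < i then q.1 else n + i + 1 - q.1}

/-- The graph of `β_{i,j}`: domain `X_n ∖ {i, j}`, reversing the interval strictly
between `i` and `j` and fixing everything else. -/
def betaGraph (n i j : ℕ) : Set (ℕ × ℕ) :=
  {q | 1 ≤ q.1 ∧ q.1 ≤ n ∧ q.1 ≠ i ∧ q.1 ≠ j ∧
    q.2 = if i < q.1 ∧ q.1 < j then i + j - q.1 else q.1}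

/-- The generating system `G` (for even `n`), given elements `σ₁, σ₂` and families
`γ, δ` realizing the prescribed graphs. -/
def Gset (n : ℕ) (σ₁ σ₂ : PartialInj n) (γ δ : ℕ → PartialInj n) : Set (PartialInj n) :=
  {pid n (Set.Icc 1 n), σ₁, σ₂} ∪
    {g | ∃ i, Even i ∧ 4 ≤ i ∧ i ≤ n ∧ g = γ i} ∪
    {g | ∃ i, Odd i ∧ i ≤ n - 3 ∧ g = δ i}

namespace PartialInj

variable {n : ℕ}

/-! ### Inverses, products and the classes `IF_n` and `J` -/

theorem mul_inv_rev (α β : PartialInj n) : (α * β).inv = β.inv * α.inv := by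
  apply ext'
  ext p
  constructor
  · rintro ⟨y, h1, h2⟩
    exact ⟨y, h2, h1⟩
  · rintro ⟨y, h1, h2⟩
    exact ⟨y, h2, h1⟩

theorem dom_ncard (α : PartialInj n) : α.dom.ncard = α.im.ncard := by
  have h : ∀ x, x ∈ α.dom → ∃ y, (x, y) ∈ α.graph := fun _ hx => hx
  choose f hf using h
  refine Set.ncard_congr f (fun a ha => ⟨a, hf a ha⟩) ?_ ?_
  · intro a b ha hb hab
    exact α.injOn _ (hf a ha) _ (hf b hb) hab
  · rintro b ⟨a, hab⟩
    exact ⟨a, ⟨b, hab⟩, α.functional _ (hf a ⟨b, hab⟩) _ hab rfl⟩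

theorem inv_mem_IFset {α : PartialInj n} (h : α ∈ IFset n) : α.inv ∈ IFset n :=
  ⟨h.2, h.1⟩

theorem FP.mul {α β : PartialInj n} (hα : α.FP) (hβ : β.FP) : (α * β).FP := by
  rintro p ⟨y, h1, h2⟩ q ⟨z, h3, h4⟩ h
  exact hβ (y, p.2) h2 (z, q.2) h4 (hα (p.1, y) h1 (q.1, z) h3 h)

theorem mul_mem_IFset {α β : PartialInj n} (hα : α ∈ IFset n) (hβ : β ∈ IFset n) :
    α * β ∈ IFset n := by
  refine ⟨hα.1.mul hβ.1, ?_⟩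
  rw [mul_inv_rev]
  exact hβ.2.mul hα.2

theorem inv_mem_Jset {α : PartialInj n} (h : α ∈ Jset n) : α.inv ∈ Jset n := by
  refine ⟨inv_mem_IFset h.1, ?_⟩
  have : α.inv.rank = α.rank := α.dom_ncard
  rw [this]
  exact h.2

theorem inv_mem_closure {α : PartialInj n} (h : α ∈ Subsemigroup.closure (Jset n)) :
    α.inv ∈ Subsemigroup.closure (Jset n) := by
  induction h using Subsemigroup.closure_induction with
  | mem x hx => exact Subsemigroup.subset_closure (inv_mem_Jset hx)
  | mul x y _ _ hx hy =>
    rw [mul_inv_rev]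
    exact mul_mem hy hx

theorem le_rank {α : PartialInj n} (a b : ℕ)
    (h : ∀ y, 1 ≤ y → y ≤ n → y ≠ a → y ≠ b → y ∈ α.im) : n - 2 ≤ α.rank := by
  have hfin : α.im.Finite := by
    refine (Set.finite_Icc 1 n).subset ?_
    rintro y ⟨x, hx⟩
    exact (α.mem_le _ hx).2.2
  have hsub : (((Finset.Icc 1 n).erase a).erase b : Set ℕ) ⊆ α.im := by
    intro y hy
    simp only [Finset.coe_erase, Finset.coe_Icc, Set.mem_sdiff, Set.mem_Icc,
      Set.mem_singleton_iff] at hy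
    exact h y hy.1.1.1 hy.1.1.2 hy.1.2 hy.2
  have h1 := Set.ncard_le_ncard hsub hfin
  have h2 := Finset.pred_card_le_card_erase (s := (Finset.Icc 1 n).erase a) (a := b)
  have h3 := Finset.pred_card_le_card_erase (s := Finset.Icc 1 n) (a := a)
  rw [Set.ncard_coe_finset] at h1
  rw [Nat.card_Icc] at h3
  unfold rank
  omega

/-! ### Interval reversals and moves of an isolated point -/

/-- The partial injection with graph `betaGraph n i j`, where `i` and `j` may also be the
virtual points `0` and `n + 1`. -/
def reversal (n i j : ℕ) (h : j ≤ n + 1) : PartialInj n where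
  graph := betaGraph n i j
  mem_le := by
    rintro ⟨x, y⟩ ⟨h1, h2, h3, h4, h5⟩
    dsimp only at *
    split_ifs at h5 <;> omega
  functional := by
    rintro ⟨x, y⟩ ⟨h1, h2, h3, h4, h5⟩ ⟨x', y'⟩ ⟨h1', h2', h3', h4', h5'⟩ hxx
    dsimp only at *
    subst hxx
    rw [h5, h5']
  injOn := by
    rintro ⟨x, y⟩ ⟨h1, h2, h3, h4, h5⟩ ⟨x', y'⟩ ⟨h1', h2', h3', h4', h5'⟩ hxx
    dsimp only at *
    split_ifs at h5 h5' <;> omega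

theorem reversal_inv (i j : ℕ) (h : j ≤ n + 1) : (reversal n i j h).inv = reversal n i j h := by
  apply ext'
  ext ⟨x, y⟩
  simp only [reversal, inv, betaGraph, Set.mem_ofPred_eq]
  constructor <;>
  · rintro ⟨h1, h2, h3, h4, h5⟩
    split_ifs at h5 ⊢ <;> omega

theorem reversal_FP {i j : ℕ} (h : j ≤ n + 1) (hij : i % 2 = j % 2) :
    (reversal n i j h).FP := by
  rintro ⟨x, y⟩ ⟨h1, h2, h3, h4, h5⟩ ⟨x', y'⟩ ⟨h1', h2', h3', h4', h5'⟩
  simp only [fenceLt, Nat.even_iff] at *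
  split_ifs at h5 h5' <;> omega

theorem reversal_mem_Jset {i j : ℕ} (h : j ≤ n + 1) (hij : i % 2 = j % 2) :
    reversal n i j h ∈ Jset n := by
  refine ⟨⟨reversal_FP h hij, by rw [reversal_inv]; exact reversal_FP h hij⟩, le_rank i j ?_⟩
  intro y h1 h2 h3 h4
  refine ⟨if i < y ∧ y < j then i + j - y else y, ?_⟩
  change _ ∈ betaGraph n i j
  simp only [betaGraph, Set.mem_ofPred_eq]
  split_ifs <;> omega

/-- The partial injection with domain `X_n ∖ {2, m}` that moves the isolated point `1` to `m - 1`
and shifts the interval strictly between `2` and `m` down by two. -/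
def pointShift (n m : ℕ) (h2 : 2 ≤ m) (h : m ≤ n + 1) : PartialInj n where
  graph := {q | 1 ≤ q.1 ∧ q.1 ≤ n ∧ q.1 ≠ 2 ∧ q.1 ≠ m ∧
    q.2 = if q.1 = 1 then m - 1 else if q.1 < m then q.1 - 2 else q.1}
  mem_le := by
    rintro ⟨x, y⟩ ⟨h1, h2, h3, h4, h5⟩
    dsimp only at *
    split_ifs at h5 <;> omega
  functional := by
    rintro ⟨x, y⟩ ⟨h1, h2, h3, h4, h5⟩ ⟨x', y'⟩ ⟨h1', h2', h3', h4', h5'⟩ hxx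
    dsimp only at *
    subst hxx
    rw [h5, h5']
  injOn := by
    rintro ⟨x, y⟩ ⟨h1, h2, h3, h4, h5⟩ ⟨x', y'⟩ ⟨h1', h2', h3', h4', h5'⟩ hxx
    dsimp only at *
    split_ifs at h5 h5' <;> omega

theorem pointShift_mem_Jset {m : ℕ} (h2 : 2 ≤ m) (h : m ≤ n + 1) :
    pointShift n m h2 h ∈ Jset n := by
  refine ⟨⟨?_, ?_⟩, le_rank (m - 2) m ?_⟩
  · rintro ⟨x, y⟩ ⟨h1, h2, h3, h4, h5⟩ ⟨x', y'⟩ ⟨h1', h2', h3', h4', h5'⟩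
    simp only [fenceLt, Nat.even_iff] at *
    split_ifs at h5 h5' <;> omega
  · rintro ⟨x, y⟩ ⟨h1, h2, h3, h4, h5⟩ ⟨x', y'⟩ ⟨h1', h2', h3', h4', h5'⟩
    simp only [fenceLt, Nat.even_iff] at *
    split_ifs at h5 h5' <;> omega
  · intro y h1 h2 h3 h4
    refine ⟨if y = m - 1 then 1 else if y < m then y + 2 else y, ?_⟩
    simp only [pointShift, Set.mem_ofPred_eq]
    split_ifs <;> omega

/-- Moving an isolated point from `p + 1` down to `k + 1`. -/
def pointMove (n k p : ℕ) (hkp : k ≤ p) (h : p + 2 ≤ n + 1) : PartialInj n :=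
  (pointShift n (p + 2) (by omega) h).inv * pointShift n (k + 2) (by omega) (by omega)

theorem mem_pointMove {k p x y : ℕ} (hkp : k ≤ p) (h : p + 2 ≤ n + 1) :
    (x, y) ∈ (pointMove n k p hkp h).graph ↔
      1 ≤ x ∧ x ≤ n ∧ x ≠ k ∧ x ≠ p ∧ x ≠ p + 2 ∧
        y = if x = p + 1 then k + 1 else if k < x ∧ x < p then x + 2 else x := by
  simp only [pointMove, mul_graph, pointShift, inv, Set.mem_ofPred_eq]
  constructor
  · rintro ⟨z, ⟨h1, h2, h3, h4, h5⟩, ⟨h1', h2', h3', h4', h5'⟩⟩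
    split_ifs at h5 h5' ⊢ <;> omega
  · rintro ⟨h1, h2, h3, h4, h5, h6⟩
    refine ⟨if x = p + 1 then 1 else if x < p then x + 2 else x, ?_⟩
    split_ifs at h6 ⊢ <;> omega

/-! ### Extension to an element of `⟨J⟩` -/

/-- `α` is a restriction of an element of `⟨J⟩`. -/
def ExtendsToClosure (α : PartialInj n) : Prop :=
  ∃ ω ∈ Subsemigroup.closure (Jset n), α.graph ⊆ ω.graph

theorem ExtendsToClosure.of_inv {α : PartialInj n} (h : α.inv.ExtendsToClosure) :
    α.ExtendsToClosure := by
  obtain ⟨ω, hω, hsub⟩ := h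
  exact ⟨ω.inv, inv_mem_closure hω, fun p hp => hsub (a := (p.2, p.1)) hp⟩

theorem ExtendsToClosure.of_mul {α β : PartialInj n}
    (hβ : β ∈ Subsemigroup.closure (Jset n)) (him : α.im ⊆ β.dom)
    (h : (α * β).ExtendsToClosure) : α.ExtendsToClosure := by
  obtain ⟨ω, hω, hsub⟩ := h
  refine ⟨ω * β.inv, mul_mem hω (inv_mem_closure hβ), ?_⟩
  rintro ⟨x, y⟩ hp
  obtain ⟨z, hz⟩ := him ⟨x, hp⟩
  exact ⟨z, hsub ⟨y, hp, hz⟩, hz⟩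

/-- `α` is the identity below `k`, maps no point across `k`, and leaves `k` unused. -/
def AgreesUpTo (k : ℕ) (α : PartialInj n) : Prop :=
  ∀ x y, (x, y) ∈ α.graph → x ≤ k ∨ y ≤ k → x = y ∧ x ≠ k

theorem AgreesUpTo.inv {k : ℕ} {α : PartialInj n} (h : AgreesUpTo k α) :
    AgreesUpTo k α.inv := by
  intro x y hxy hk
  obtain ⟨h1, h2⟩ := h y x hxy hk.symm
  exact ⟨h1.symm, h1 ▸ h2⟩

theorem AgreesUpTo.extend {k m : ℕ} {α : PartialInj n} (h : AgreesUpTo k α)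
    (hid : ∀ x, k < x → x < m → (x, x) ∈ α.graph) (hdom : m ∉ α.dom) (him : m ∉ α.im) :
    AgreesUpTo m α := by
  intro x y hxy hm
  have hxm : x ≠ m := by
    rintro rfl
    exact hdom ⟨y, hxy⟩
  have hym : y ≠ m := by
    rintro rfl
    exact him ⟨x, hxy⟩
  refine ⟨?_, hxm⟩
  by_cases hk : x ≤ k ∨ y ≤ k
  · exact (h x y hxy hk).1
  · rcases hm with hm | hm
    · exact α.functional _ (hid x (by omega) (by omega)) _ hxy rfl
    · exact α.injOn _ hxy _ (hid y (by omega) (by omega)) rfl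

theorem mem_mul_reversal {α : PartialInj n} {i j x y : ℕ} (h : j ≤ n + 1) :
    (x, y) ∈ (α * reversal n i j h).graph ↔
      ∃ z, (x, z) ∈ α.graph ∧ z ≠ i ∧ z ≠ j ∧ y = if i < z ∧ z < j then i + j - z else z := by
  constructor
  · rintro ⟨z, h1, -, -, h2⟩
    exact ⟨z, h1, h2⟩
  · rintro ⟨z, h1, h2⟩
    obtain ⟨-, -, h3, h4⟩ := α.mem_le _ h1
    exact ⟨z, h1, h3, h4, h2⟩

theorem notMem_im_mul_reversal {α : PartialInj n} {i j y : ℕ} (h : j ≤ n + 1)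
    (hi : i ≤ y) (hj : y ≤ j) (hy : i + j - y ∉ α.im) :
    y ∉ (α * reversal n i j h).im := by
  rintro ⟨x, hx⟩
  obtain ⟨z, h1, h2, h3, h4⟩ := (mem_mul_reversal h).1 hx
  have : z = i + j - y := by split_ifs at h4 <;> omega
  exact hy ⟨x, this ▸ h1⟩

theorem notMem_dom_mul {α β : PartialInj n} {x : ℕ} (h : x ∉ α.dom) : x ∉ (α * β).dom := by
  rintro ⟨y, z, h1, -⟩
  exact h ⟨z, h1⟩

theorem AgreesUpTo.mul_reversal {k i j : ℕ} {α : PartialInj n} (hα : AgreesUpTo k α)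
    (hki : k ≤ i) (h : j ≤ n + 1) : AgreesUpTo k (α * reversal n i j h) := by
  intro x y hxy hk
  obtain ⟨z, h1, h2, h3, h4⟩ := (mem_mul_reversal h).1 hxy
  have := hα x z h1
  split_ifs at h4 <;> omega

theorem ExtendsToClosure.of_mul_reversal {α : PartialInj n} {i j : ℕ} (h : j ≤ n + 1)
    (hij : i % 2 = j % 2) (hi : i ∉ α.im) (hj : j ∉ α.im)
    (hext : (α * reversal n i j h).ExtendsToClosure) : α.ExtendsToClosure := by
  refine of_mul (Subsemigroup.subset_closure (reversal_mem_Jset h hij)) ?_ hext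
  rintro y ⟨x, hx⟩
  obtain ⟨-, -, h3, h4⟩ := α.mem_le _ hx
  refine ⟨if i < y ∧ y < j then i + j - y else y, h3, h4, ?_, ?_, rfl⟩
  · intro hyi
    exact hi ⟨x, hyi ▸ hx⟩
  · intro hyj
    exact hj ⟨x, hyj ▸ hx⟩

theorem AgreesUpTo.notMem_im {k : ℕ} {α : PartialInj n} (h : AgreesUpTo k α) : k ∉ α.im := by
  rintro ⟨x, hx⟩
  have := h x k hx (Or.inr le_rfl)
  omega

/-! ### The image of a block -/

theorem adjacent_images {α : PartialInj n} (hα : α ∈ IFset n) {x u v : ℕ}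
    (hu : (x, u) ∈ α.graph) (hv : (x + 1, v) ∈ α.graph) :
    (u + 1 = v ∨ v + 1 = u) ∧ u % 2 = x % 2 := by
  have h1 := hα.1 _ hu _ hv
  have h2 := hα.1 _ hv _ hu
  simp only [fenceLt, Nat.even_iff] at h1 h2
  rcases Nat.mod_two_eq_zero_or_one x with hx | hx
  · have := h2 ⟨by simp, hx⟩
    omega
  · have := h1 ⟨by simp, by omega⟩
    omega

/-- A block of length at least two is translated or reflected onto a block. -/
theorem block_image {α : PartialInj n} (hα : α ∈ IFset n) {k m : ℕ} (hkm : k + 3 ≤ m)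
    (hk : k ∉ α.dom) (hm : m ∉ α.dom) (hd : ∀ x, k < x → x < m → x ∈ α.dom) :
    ∃ p, p ∉ α.im ∧ p + m - k ∉ α.im ∧
      ((p % 2 = k % 2 ∧ ∀ x, k < x → x < m → (x, p + x - k) ∈ α.graph) ∨
        (p % 2 = m % 2 ∧ ∀ x, k < x → x < m → (x, p + m - x) ∈ α.graph)) := by
  obtain ⟨u, hu⟩ := hd (k + 1) (by omega) (by omega)
  obtain ⟨v, hv⟩ := hd (k + 1 + 1) (by omega) (by omega)
  obtain ⟨huv, hpar⟩ := adjacent_images hα hu hv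
  have hu1 := (α.mem_le _ hu).2.2.1
  have hv1 := (α.mem_le _ hv).2.2.1
  dsimp only at hu1 hv1
  have hα' := inv_mem_IFset hα
  rcases huv with huv | huv
  · have key : ∀ t, k + 1 + t + 1 < m →
        (k + 1 + t, u + t) ∈ α.graph ∧ (k + 1 + t + 1, u + t + 1) ∈ α.graph := by
      intro t
      induction t with
      | zero =>
        intro _
        subst huv
        exact ⟨hu, hv⟩
      | succ t ih =>
        intro ht
        obtain ⟨h1, h2⟩ := ih (by omega)
        refine ⟨h2, ?_⟩
        obtain ⟨w, hw⟩ := hd (k + 1 + t + 1 + 1) (by omega) (by omega)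
        obtain ⟨h3 | h3, -⟩ := adjacent_images hα h2 hw
        · subst h3
          exact hw
        · have := α.injOn _ h1 _ hw (by dsimp only; omega)
          dsimp only at this
          omega
    have key' : ∀ x, k < x → x < m → (x, u - 1 + x - k) ∈ α.graph := by
      intro x h1 h2
      by_cases hx : x = k + 1
      · subst hx
        convert hu using 2
        omega
      · convert (key (x - k - 2) (by omega)).2 using 2 <;> omega
    refine ⟨u - 1, ?_, ?_, Or.inl ⟨by omega, key'⟩⟩
    · rintro ⟨z, hz⟩
      have hu' : (u - 1 + 1, k + 1) ∈ α.inv.graph := by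
        rw [Nat.sub_add_cancel hu1]
        exact hu
      obtain ⟨h3 | h3, -⟩ := adjacent_images hα' (x := u - 1) (u := z) hz hu'
      · exact hk ⟨_, (show z = k by omega) ▸ hz⟩
      · have := α.functional _ hz _ hv (by dsimp only; omega)
        dsimp only at this
        omega
    · rintro ⟨z, hz⟩
      have h1 : (u - 1 + (m - 1) - k, m - 1) ∈ α.inv.graph := key' (m - 1) (by omega) (by omega)
      have h2 := key' (m - 2) (by omega) (by omega)
      have hz' : (u - 1 + (m - 1) - k + 1, z) ∈ α.inv.graph := by
        rw [show u - 1 + (m - 1) - k + 1 = u - 1 + m - k by omega]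
        exact hz
      obtain ⟨h3 | h3, -⟩ := adjacent_images hα' h1 hz'
      · exact hm ⟨_, (show z = m by omega) ▸ hz⟩
      · have := α.functional _ hz _ h2 (by dsimp only; omega)
        dsimp only at this
        omega
  · have key : ∀ t, k + 1 + t + 1 < m → t + 1 < u ∧
        (k + 1 + t, u - t) ∈ α.graph ∧ (k + 1 + t + 1, u - t - 1) ∈ α.graph := by
      intro t
      induction t with
      | zero =>
        intro _
        subst huv
        exact ⟨by omega, hu, hv⟩
      | succ t ih =>
        intro ht
        obtain ⟨h0, h1, h2⟩ := ih (by omega)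
        obtain ⟨w, hw⟩ := hd (k + 1 + t + 1 + 1) (by omega) (by omega)
        have hw1 := (α.mem_le _ hw).2.2.1
        dsimp only at hw1
        obtain ⟨h3 | h3, -⟩ := adjacent_images hα h2 hw
        · have := α.injOn _ h1 _ hw (by dsimp only; omega)
          dsimp only at this
          omega
        · refine ⟨by omega, h2, ?_⟩
          rwa [show u - (t + 1) - 1 = w by omega]
    have hum : m ≤ u + k + 1 := by
      have := (key (m - k - 3) (by omega)).1
      omega
    have key' : ∀ x, k < x → x < m → (x, u + k + 1 - m + m - x) ∈ α.graph := by
      intro x h1 h2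
      by_cases hx : x = k + 1
      · subst hx
        convert hu using 2
        omega
      · convert (key (x - k - 2) (by omega)).2.2 using 2 <;> omega
    refine ⟨u + k + 1 - m, ?_, ?_, Or.inr ⟨by omega, key'⟩⟩
    · rintro ⟨z, hz⟩
      have h1 : (u + k + 1 - m + m - (m - 1), m - 1) ∈ α.inv.graph :=
        key' (m - 1) (by omega) (by omega)
      have h2 := key' (m - 2) (by omega) (by omega)
      have h1' : (u + k + 1 - m + 1, m - 1) ∈ α.inv.graph := by
        rw [show u + k + 1 - m + 1 = u + k + 1 - m + m - (m - 1) by omega]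
        exact h1
      obtain ⟨h3 | h3, -⟩ := adjacent_images hα' (u := z) hz h1'
      · have := α.functional _ hz _ h2 (by dsimp only; omega)
        dsimp only at this
        omega
      · exact hm ⟨_, (show z = m by omega) ▸ hz⟩
    · rintro ⟨z, hz⟩
      have hz' : (u + 1, z) ∈ α.inv.graph := by
        rw [show u + 1 = u + k + 1 - m + m - k by omega]
        exact hz
      obtain ⟨h3 | h3, -⟩ := adjacent_images hα' (u := k + 1) hu hz'
      · have := α.functional _ hz _ hv (by dsimp only; omega)
        dsimp only at this
        omega
      · exact hk ⟨_, (show z = k by omega) ▸ hz⟩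

/-! ### Extending the agreement by one block -/

theorem extends_of_reflected {α : PartialInj n} (hα : α ∈ IFset n) {k m p : ℕ} (hkm : k + 1 < m)
    (IH : ∀ β ∈ IFset n, AgreesUpTo m β → β.ExtendsToClosure)
    (hk : AgreesUpTo k α) (hm : m ∉ α.dom) (hp : p ∉ α.im) (hq : p + m - k ∉ α.im)
    (hpar : p % 2 = m % 2) (hrefl : ∀ x, k < x → x < m → (x, p + m - x) ∈ α.graph) :
    α.ExtendsToClosure := by
  have h1 := hrefl (m - 1) (by omega) (by omega)
  have h2 := hrefl (k + 1) (by omega) (by omega)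
  have hkp : k ≤ p := by
    have := hk _ _ h1
    omega
  have hqn : p + m - k ≤ n + 1 := by
    have := (α.mem_le _ h2).2.2.2
    dsimp only at this
    omega
  have hpar' : k % 2 = (p + m - k) % 2 := by omega
  refine .of_mul_reversal hqn hpar' hk.notMem_im hq (IH _ ?_ ?_)
  · exact mul_mem_IFset hα (reversal_mem_Jset hqn hpar').1
  · refine (hk.mul_reversal le_rfl hqn).extend ?_ (notMem_dom_mul hm)
      (notMem_im_mul_reversal hqn (by omega) (by omega) ?_)
    · intro x hx1 hx2
      refine (mem_mul_reversal hqn).2 ⟨_, hrefl x hx1 hx2, by omega, by omega, ?_⟩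
      split_ifs <;> omega
    · rwa [show k + (p + m - k) - m = p by omega]

theorem extends_of_isolated {α : PartialInj n} (hα : α ∈ IFset n) {k : ℕ}
    (IH : ∀ β ∈ IFset n, AgreesUpTo (k + 2) β → β.ExtendsToClosure)
    (hk : AgreesUpTo k α) (hkd : k ∉ α.dom) (hd : k + 1 ∈ α.dom) (hm : k + 2 ∉ α.dom) :
    α.ExtendsToClosure := by
  obtain ⟨u, hu⟩ := hd
  obtain ⟨p, rfl⟩ : ∃ p, u = p + 1 := by
    have := (α.mem_le _ hu).2.2.1
    exact ⟨u - 1, by dsimp only at this; omega⟩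
  have hkp : k ≤ p := by
    have := hk _ _ hu
    omega
  have hpn : p + 2 ≤ n + 1 := by
    have := (α.mem_le _ hu).2.2.2
    dsimp only at this
    omega
  have hα' := inv_mem_IFset hα
  have hp : p ∉ α.im := by
    rintro ⟨z, hz⟩
    obtain ⟨h3 | h3, -⟩ := adjacent_images hα' (x := p) (u := z) (v := k + 1) hz hu
    · exact hkd ⟨_, (show z = k by omega) ▸ hz⟩
    · exact hm ⟨_, (show z = k + 2 by omega) ▸ hz⟩
  have hq : p + 2 ∉ α.im := by
    rintro ⟨z, hz⟩
    obtain ⟨h3 | h3, -⟩ := adjacent_images hα' (x := p + 1) (u := k + 1) (v := z) hu hz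
    · exact hm ⟨_, (show z = k + 2 by omega) ▸ hz⟩
    · exact hkd ⟨_, (show z = k by omega) ▸ hz⟩
  have hk' := hk.notMem_im
  have hS := inv_mem_Jset (pointShift_mem_Jset (n := n) (m := p + 2) (by omega) hpn)
  have hT := pointShift_mem_Jset (n := n) (m := k + 2) (by omega) (by omega)
  refine .of_mul (β := pointMove n k p hkp hpn)
    (mul_mem (Subsemigroup.subset_closure hS) (Subsemigroup.subset_closure hT)) ?_
    (IH _ (mul_mem_IFset hα (mul_mem_IFset hS.1 hT.1)) ?_)
  · rintro y ⟨x, hx⟩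
    obtain ⟨-, -, h3, h4⟩ := α.mem_le _ hx
    refine ⟨_, (mem_pointMove hkp hpn).2 ⟨h3, h4, ?_, ?_, ?_, rfl⟩⟩
    · rintro rfl
      exact hk' ⟨x, hx⟩
    · rintro rfl
      exact hp ⟨x, hx⟩
    · rintro rfl
      exact hq ⟨x, hx⟩
  · refine AgreesUpTo.extend (k := k) ?_ ?_ (notMem_dom_mul hm) ?_
    · rintro x y ⟨z, h1, h2⟩ hxy
      obtain ⟨-, -, h3, h4, h5, h6⟩ := (mem_pointMove hkp hpn).1 h2
      have := hk _ _ h1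
      dsimp only at *
      split_ifs at h6 <;> omega
    · intro x hx1 hx2
      obtain rfl : x = k + 1 := by omega
      exact ⟨p + 1, hu, (mem_pointMove hkp hpn).2
        ⟨by omega, by omega, by omega, by omega, by omega, by simp⟩⟩
    · rintro ⟨x, z, h1, h2⟩
      obtain ⟨-, -, h3, h4, h5, h6⟩ := (mem_pointMove hkp hpn).1 h2
      dsimp only at *
      split_ifs at h6 <;> omega

theorem extends_of_odd_block {α : PartialInj n} (hα : α ∈ IFset n) {k m : ℕ} (hkm : k + 1 < m)
    (hpar : k % 2 = m % 2) (IH : ∀ β ∈ IFset n, AgreesUpTo m β → β.ExtendsToClosure)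
    (hk : AgreesUpTo k α) (hkd : k ∉ α.dom) (hm : m ∉ α.dom)
    (hd : ∀ x, k < x → x < m → x ∈ α.dom) : α.ExtendsToClosure := by
  by_cases hm2 : m = k + 2
  · subst hm2
    exact extends_of_isolated hα IH hk hkd (hd _ (by omega) (by omega)) hm
  obtain ⟨p, hp, hq, ⟨hpp, htr⟩ | ⟨hpp, hrefl⟩⟩ := block_image hα (by omega) hkd hm hd
  · have h1 := htr (k + 1) (by omega) (by omega)
    have h2 := htr (m - 1) (by omega) (by omega)
    have hkp : k ≤ p := by
      have := hk _ _ h1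
      omega
    have hqn : p + m - k ≤ n + 1 := by
      have := (α.mem_le _ h2).2.2.2
      dsimp only at this
      omega
    have hpar' : k % 2 = (p + m - k) % 2 := by omega
    have hm' : m ∉ (α * reversal n k (p + m - k) hqn).im := by
      refine notMem_im_mul_reversal hqn (by omega) (by omega) ?_
      rwa [show k + (p + m - k) - m = p by omega]
    refine .of_mul_reversal hqn hpar' hk.notMem_im hq
      (extends_of_reflected (p := k) (mul_mem_IFset hα (reversal_mem_Jset hqn hpar').1) hkm IH
        (hk.mul_reversal le_rfl hqn) (notMem_dom_mul hm)
        (hk.mul_reversal le_rfl hqn).notMem_im ?_ hpar ?_)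
    · rwa [show k + m - k = m by omega]
    · intro x hx1 hx2
      refine (mem_mul_reversal hqn).2 ⟨_, htr x hx1 hx2, by omega, by omega, ?_⟩
      split_ifs <;> omega
  · exact extends_of_reflected hα hkm IH hk hm hp hq hpp hrefl

theorem extends_of_even_block {α : PartialInj n} (hα : α ∈ IFset n) {k m c : ℕ} (hkm : k + 1 < m)
    (hpar : k % 2 ≠ m % 2) (IH : ∀ β ∈ IFset n, AgreesUpTo m β → β.ExtendsToClosure)
    (hk : AgreesUpTo k α) (hkd : k ∉ α.dom) (hm : m ∉ α.dom)
    (hd : ∀ x, k < x → x < m → x ∈ α.dom)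
    (hkc : k < c) (hc : c ∉ α.im) (hcpar : k % 2 ≠ c % 2)
    (hcd : ∀ y, k < y → y < c → y ∈ α.im) : α.ExtendsToClosure := by
  obtain ⟨p, hp, hq, ⟨hpp, htr⟩ | ⟨hpp, hrefl⟩⟩ := block_image hα (by omega) hkd hm hd
  · have h1 := htr (k + 1) (by omega) (by omega)
    have h2 := htr (m - 1) (by omega) (by omega)
    have hkp : k ≤ p := by
      have := hk _ _ h1
      omega
    have hqn : p + m - k ≤ n + 1 := by
      have := (α.mem_le _ h2).2.2.2
      dsimp only at this
      omega
    by_cases hpk : p = k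
    · subst hpk
      refine IH _ hα (hk.extend ?_ hm ?_)
      · intro x hx1 hx2
        have := htr x hx1 hx2
        rwa [Nat.add_sub_cancel_left] at this
      · rwa [Nat.add_sub_cancel_left] at hq
    have hcp : c < p := by
      by_contra hcon
      exact hp (hcd p (by omega) (by omega))
    have hpar' : c % 2 = (p + m - k) % 2 := by omega
    refine .of_mul_reversal hqn hpar' hc hq
      (extends_of_reflected (p := c) (mul_mem_IFset hα (reversal_mem_Jset hqn hpar').1) hkm IH
        (hk.mul_reversal hkc.le hqn) (notMem_dom_mul hm) ?_ ?_ (by omega) ?_)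
    · refine notMem_im_mul_reversal hqn (by omega) (by omega) ?_
      rwa [show c + (p + m - k) - c = p + m - k by omega]
    · refine notMem_im_mul_reversal hqn (by omega) (by omega) ?_
      rwa [show c + (p + m - k) - (c + m - k) = p by omega]
    · intro x hx1 hx2
      refine (mem_mul_reversal hqn).2 ⟨_, htr x hx1 hx2, by omega, by omega, ?_⟩
      split_ifs <;> omega
  · exact extends_of_reflected hα hkm IH hk hm hp hq hpp hrefl

theorem exists_least_notMem_dom (α : PartialInj n) (k : ℕ) :
    ∃ m, k < m ∧ m ∉ α.dom ∧ ∀ x, k < x → x < m → x ∈ α.dom := by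
  classical
  have hex : ∃ m, k < m ∧ m ∉ α.dom := by
    refine ⟨k + n + 1, by omega, ?_⟩
    rintro ⟨y, hy⟩
    have := (α.mem_le _ hy).2.1
    dsimp only at this
    omega
  refine ⟨Nat.find hex, (Nat.find_spec hex).1, (Nat.find_spec hex).2, ?_⟩
  intro x h1 h2
  by_contra h3
  exact Nat.find_min hex h2 ⟨h1, h3⟩

theorem extends_of_agreesUpTo (d : ℕ) : ∀ k, n ≤ k + d → ∀ α ∈ IFset n, AgreesUpTo k α →
    (α : PartialInj n).ExtendsToClosure := by
  induction d with
  | zero =>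
    intro k hk α _ hag
    have h1 := reversal_mem_Jset (n := n) (i := n + 1) (j := n + 1) le_rfl rfl
    refine ⟨_, Subsemigroup.subset_closure h1, ?_⟩
    rintro ⟨x, y⟩ hxy
    obtain ⟨h2, h3, h4, h5⟩ := α.mem_le _ hxy
    obtain ⟨rfl, -⟩ := hag x y hxy (by dsimp only at h3; omega)
    dsimp only at h2 h3
    refine ⟨h2, h3, by dsimp only; omega, by dsimp only; omega, ?_⟩
    dsimp only
    split_ifs <;> omega
  | succ d ih =>
    intro k hk α hα hag
    have IH : ∀ m, k < m → ∀ β ∈ IFset n, AgreesUpTo m β → β.ExtendsToClosure :=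
      fun m hm => ih m (by omega)
    have hkd : k ∉ α.dom := hag.inv.notMem_im
    have hki : k ∉ α.im := hag.notMem_im
    have hα' := inv_mem_IFset hα
    obtain ⟨m, hkm, hm, hd⟩ := exists_least_notMem_dom α k
    obtain ⟨c, hkc, hc, hcd⟩ := exists_least_notMem_dom α.inv k
    by_cases hmp : k % 2 = m % 2
    · exact extends_of_odd_block hα (by omega) hmp (IH m hkm) hag hkd hm hd
    by_cases hcp : k % 2 = c % 2
    · exact .of_inv (extends_of_odd_block hα' (by omega) hcp (IH c hkc) hag.inv hki hc hcd)
    by_cases hm1 : k + 1 < m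
    · exact extends_of_even_block hα hm1 hmp (IH m hkm) hag hkd hm hd hkc hc hcp hcd
    by_cases hc1 : k + 1 < c
    · exact .of_inv (extends_of_even_block hα' hc1 hcp (IH c hkc) hag.inv hki hc hcd hkm hm hmp hd)
    obtain rfl : m = k + 1 := by omega
    obtain rfl : c = k + 1 := by omega
    exact IH _ hkm _ hα (hag.extend (fun x h1 h2 => by omega) hm hc)

theorem extendsToClosure_of_mem_IFset {α : PartialInj n} (hα : α ∈ IFset n) :
    α.ExtendsToClosure := by
  refine extends_of_agreesUpTo n 0 (by omega) α hα ?_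
  intro x y hxy h
  obtain ⟨h1, -, h3, -⟩ := α.mem_le _ hxy
  dsimp only at h1 h3
  omega

end PartialInj

/-- Corollary 1: `α` can be multiplied by elements of `⟨J⟩` (with inverses in `⟨J⟩`)
so that the result is a restriction of the identity map. -/
theorem cor1 (n : ℕ) (α : PartialInj n) (hα : α ∈ IFset n) :
    ∃ ω₁ ∈ Subsemigroup.closure (Jset n), ∃ ω₂ ∈ Subsemigroup.closure (Jset n),
      ω₁.inv ∈ Subsemigroup.closure (Jset n) ∧ ω₂.inv ∈ Subsemigroup.closure (Jset n) ∧
      α.dom ⊆ ω₁.im ∧ α.im ⊆ ω₂.dom ∧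
      ∀ q ∈ (ω₁ * α * ω₂).graph, q.2 = q.1 := by
  obtain ⟨ω, hω, hsub⟩ := extendsToClosure_of_mem_IFset hα
  have h1 : (1 : PartialInj n) ∈ Jset n := by
    refine ⟨⟨?_, ?_⟩, le_rank 0 0 fun y hy1 hy2 _ _ => ⟨y, ⟨hy1, hy2⟩, ⟨hy1, hy2⟩, rfl⟩⟩
    · rintro ⟨x, y⟩ ⟨-, -, hxy⟩ ⟨x', y'⟩ ⟨-, -, hxy'⟩ h
      dsimp only at hxy hxy' h ⊢
      rwa [hxy, hxy']
    · rintro ⟨x, y⟩ ⟨-, -, hxy⟩ ⟨x', y'⟩ ⟨-, -, hxy'⟩ h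
      dsimp only at hxy hxy' h ⊢
      rwa [hxy, hxy'] at h
  refine ⟨ω.inv, inv_mem_closure hω, 1, Subsemigroup.subset_closure h1, hω,
    Subsemigroup.subset_closure (inv_mem_Jset h1), ?_, ?_, ?_⟩
  · rintro x ⟨y, hxy⟩
    exact ⟨y, hsub hxy⟩
  · rintro y ⟨x, hxy⟩
    obtain ⟨-, -, h3, h4⟩ := α.mem_le _ hxy
    exact ⟨y, ⟨h3, h4⟩, ⟨h3, h4⟩, rfl⟩
  · rw [mul_one]
    rintro ⟨x, y⟩ ⟨z, hz1, hz2⟩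
    exact ω.functional _ (hsub hz2) _ hz1 rfl

end FencePaper
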